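/- arXiv:math/0701741 — 2 statements merged into one kernel-verified Lean document; each statement's English description precedes it below -/
import Mathlib

section
/- Fix p ∈ (0, 1/2), let c := c(p), and fix s > 1. There exist ε₀ > 0 and n₀ such that for every ε ∈ (0, ε₀] with b := ε^{−3/2} a positive integer, every integer n ≥ n₀, and every infinite 0–1 sequence (x_i)_{i≥1} with x_1 + ⋯ + x_n ≥ (c−ε)·n, the number of indices j ∈ {0, 1, …, n−1} such that for every k with 1 ≤ k ≤ b one has x_{j+1} + ⋯ + x_{j+k} ≥ (c − sε)·k is at least ⌊((s−1)/(2(1−c)))·n·ε^{5/2}⌋. -/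
open Filter

noncomputable section

/-- The real value of a Boolean label. -/
def bval (b : Bool) : ℝ := if b then 1 else 0

/-- `H(p,q) = q log(p/q) + (1-q) log((1-p)/(1-q))`, the large-deviation rate. -/
def Hrate (p q : ℝ) : ℝ := q * Real.log (p / q) + (1 - q) * Real.log ((1 - p) / (1 - q))

open Classical in
lemma greedy_aux (y : ℕ → ℝ) (h0 : ∀ i, 0 ≤ y i) (h1 : ∀ i, y i ≤ 1) (d : ℝ) (hd0 : 0 ≤ d)
    (hd1 : d ≤ 1) (b n : ℕ) :
    ∀ m j : ℕ, j + m = n → ∑ i ∈ Finset.Ico (j + 1) (n + 1), y i ≤ d * m + (1 - d) *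
      (((Finset.Ico j n).filter (fun j => ∀ k : ℕ, 1 ≤ k → k ≤ b →
            d * k ≤ ∑ i ∈ Finset.Ico (j + 1) (j + k + 1), y i)).card : ℝ) + d * (1 - d) * b := by
  intro m
  induction m using Nat.strong_induction_on with
  | _ m ih =>
  intro j hj
  have hd1' : 0 ≤ 1 - d := by linarith
  have hb : 0 ≤ d * (1 - d) * b := by positivity
  rcases Nat.eq_zero_or_pos m with rfl | hm
  · have : j = n := by omega
    subst this
    simpa using hb
  by_cases hg : ∀ k : ℕ, 1 ≤ k → k ≤ b → d * k ≤ ∑ i ∈ Finset.Ico (j + 1) (j + k + 1), y i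
  · have h := ih (m - 1) (by omega) (j + 1) (by omega)
    rw [Finset.sum_eq_sum_Ico_succ_bot (by omega)]
    have e : Finset.Ico j n = insert j (Finset.Ico (j + 1) n) := by
      ext a; simp only [Finset.mem_Ico, Finset.mem_insert]; omega
    rw [e, Finset.filter_insert, if_pos hg, Finset.card_insert_of_notMem (by simp)]
    have := h1 (j + 1)
    rw [Nat.cast_sub (by omega)] at h
    push_cast at h ⊢
    linarith
  · push Not at hg
    obtain ⟨k, hk1, hkb, hk⟩ := hg
    by_cases hkm : k ≤ m
    · have h := ih (m - k) (by omega) (j + k) (by omega)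
      rw [← Finset.sum_Ico_consecutive y (show j + 1 ≤ j + k + 1 by omega)
        (show j + k + 1 ≤ n + 1 by omega)]
      have hc : (((Finset.Ico (j + k) n).filter (fun j => ∀ k : ℕ, 1 ≤ k → k ≤ b →
            d * k ≤ ∑ i ∈ Finset.Ico (j + 1) (j + k + 1), y i)).card : ℝ) ≤
          (((Finset.Ico j n).filter (fun j => ∀ k : ℕ, 1 ≤ k → k ≤ b →
            d * k ≤ ∑ i ∈ Finset.Ico (j + 1) (j + k + 1), y i)).card : ℝ) := by
        exact_mod_cast Finset.card_le_card (Finset.filter_subset_filter _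
          (Finset.Ico_subset_Ico (by omega) le_rfl))
      have := mul_le_mul_of_nonneg_left hc hd1'
      rw [Nat.cast_sub hkm] at h
      linarith
    · have ha : ∑ i ∈ Finset.Ico (j + 1) (n + 1), y i ≤ m := by
        refine (Finset.sum_le_sum (fun i _ => h1 i)).trans ?_
        simp only [Finset.sum_const, Nat.card_Ico, nsmul_eq_mul, mul_one]
        exact_mod_cast (by omega)
      have hb2 : ∑ i ∈ Finset.Ico (j + 1) (n + 1), y i ≤ d * b := by
        have h3 : ∑ i ∈ Finset.Ico (j + 1) (n + 1), y i ≤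
            ∑ i ∈ Finset.Ico (j + 1) (j + k + 1), y i :=
          Finset.sum_le_sum_of_subset_of_nonneg
            (Finset.Ico_subset_Ico le_rfl (by omega)) (fun i _ _ => h0 i)
        have : d * (k : ℝ) ≤ d * b := mul_le_mul_of_nonneg_left (by exact_mod_cast hkb) hd0
        linarith
      have hG := mul_nonneg hd1' (Nat.cast_nonneg (α := ℝ)
        ((Finset.Ico j n).filter (fun j => ∀ k : ℕ, 1 ≤ k → k ≤ b →
            d * k ≤ ∑ i ∈ Finset.Ico (j + 1) (j + k + 1), y i)).card)
      have h4 := mul_le_mul_of_nonneg_left ha hd0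
      have h5 := mul_le_mul_of_nonneg_left hb2 hd1'
      linarith

/-- Lemma 5.2, deterministic counting of good indices.
Fix `p ∈ (0,1/2)`, `c = c(p)` (the unique `q ∈ (p,1)` with `H(p,q) = -log 2`) and
`s > 1`.  There are `ε₀ > 0` and `n₀` such that for every `ε ∈ (0, ε₀]` with
`b = ε^{-3/2}` a positive integer, every `n ≥ n₀` and every 0–1 sequence `(x_i)_{i ≥ 1}`
with `x_1 + ⋯ + x_n ≥ (c-ε)n`, the number of indices `j ∈ {0, …, n-1}` such that
`x_{j+1} + ⋯ + x_{j+k} ≥ (c-sε)k` for all `1 ≤ k ≤ b` is at least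
`⌊((s-1)/(2(1-c))) n ε^{5/2}⌋`. -/
theorem good_indices_count
    (p : ℝ) (hp0 : 0 < p) (hp : p < 1 / 2)
    (c : ℝ) (hc : c ∈ Set.Ioo p 1) (hcH : Hrate p c = -Real.log 2)
    (s : ℝ) (hs : 1 < s) :
    ∃ ε₀ > (0 : ℝ), ∃ n₀ : ℕ,
      ∀ ε : ℝ, 0 < ε → ε ≤ ε₀ →
      ∀ b : ℕ, 0 < b → (b : ℝ) = ε ^ (-(3 / 2) : ℝ) →
      ∀ n : ℕ, n₀ ≤ n →
      ∀ x : ℕ → Bool,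
        (c - ε) * n ≤ ∑ i ∈ Finset.Icc 1 n, bval (x i) →
        Nat.floor ((s - 1) / (2 * (1 - c)) * n * ε ^ ((5 : ℝ) / 2)) ≤
          {j : ℕ | j < n ∧ ∀ k : ℕ, 1 ≤ k → k ≤ b →
            (c - s * ε) * k ≤ ∑ i ∈ Finset.Icc (j + 1) (j + k), bval (x i)}.ncard := by
  obtain ⟨hpc, hc1⟩ := hc
  have hc0 : 0 < c := hp0.trans hpc
  have hs0 : 0 < s := by linarith
  have hc1' : 0 < 1 - c := by linarith
  refine ⟨min (1 / 4) (min (c / s) ((1 - c) / (3 * s))), by positivity, 0, ?_⟩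
  intro ε hε hε0 b hb0 hb n _ x hx
  simp only [le_min_iff] at hε0
  obtain ⟨he1, he2, he3⟩ := hε0
  rw [le_div_iff₀ hs0] at he2
  rw [le_div_iff₀ (by positivity)] at he3
  classical
  have hI : ∀ a b : ℕ, Finset.Icc a b = Finset.Ico a (b + 1) := by
    intro a b; ext; simp only [Finset.mem_Icc, Finset.mem_Ico]; omega
  have key := greedy_aux (fun i => bval (x i)) (fun i => by unfold bval; split_ifs <;> norm_num)
    (fun i => by unfold bval; split_ifs <;> norm_num) (c - s * ε) (by linarith)
    (by nlinarith) b n n 0 (by omega)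
  have hset : {j : ℕ | j < n ∧ ∀ k : ℕ, 1 ≤ k → k ≤ b →
            (c - s * ε) * k ≤ ∑ i ∈ Finset.Icc (j + 1) (j + k), bval (x i)} =
      ↑((Finset.Ico 0 n).filter (fun j => ∀ k : ℕ, 1 ≤ k → k ≤ b →
            (c - s * ε) * k ≤ ∑ i ∈ Finset.Ico (j + 1) (j + k + 1), bval (x i))) := by
    ext j; simp [hI]
  rw [hset, Set.ncard_coe_finset]
  rw [hI] at hx
  rw [zero_add] at key
  generalize ((Finset.Ico 0 n).filter (fun j => ∀ k : ℕ, 1 ≤ k → k ≤ b →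
            (c - s * ε) * k ≤ ∑ i ∈ Finset.Ico (j + 1) (j + k + 1), bval (x i))).card = G at key ⊢
  have h52 : ε ^ ((5 : ℝ) / 2) = ε * ε ^ ((3 : ℝ) / 2) := by
    rw [show (5 : ℝ) / 2 = 1 + 3 / 2 by norm_num, Real.rpow_add hε, Real.rpow_one]
  have hbe : (b : ℝ) * ε ^ ((3 : ℝ) / 2) = 1 := by
    rw [hb, ← Real.rpow_add hε]; norm_num
  have he : ε ^ ((3 : ℝ) / 2) ≤ 1 / 4 := by
    refine (Real.rpow_le_rpow_of_exponent_ge hε (by linarith)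
      (show (1 : ℝ) ≤ 3 / 2 by norm_num)).trans ?_
    rwa [Real.rpow_one]
  have hepos : 0 < ε ^ ((3 : ℝ) / 2) := Real.rpow_pos_of_pos hε _
  rw [h52]
  generalize ε ^ ((3 : ℝ) / 2) = e at *
  rcases Nat.eq_zero_or_pos (⌊(s - 1) / (2 * (1 - c)) * n * (ε * e)⌋₊) with h | h
  · rw [h]; exact Nat.zero_le _
  have h1 : 1 ≤ (s - 1) / (2 * (1 - c)) * n * (ε * e) := by
    by_contra hlt
    rw [Nat.floor_eq_zero.mpr (not_le.mp hlt)] at h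
    omega
  have hfl : (s - 1) / (2 * (1 - c)) * n * (ε * e) ≤ G := by
    have hz : ∃ z, z = (s - 1) / (2 * (1 - c)) * n * ε := ⟨_, rfl⟩
    obtain ⟨z, hz⟩ := hz
    have hz2 : (s - 1) * ε * n = 2 * (1 - c) * z := by
      rw [hz]; field_simp
    have hze : (s - 1) / (2 * (1 - c)) * n * (ε * e) = z * e := by rw [hz]; ring
    rw [hze] at h1 ⊢
    have hbz : (b : ℝ) ≤ z := by
      have : (b : ℝ) * e ≤ z * e := by rw [hbe]; exact h1
      exact le_of_mul_le_mul_right this hepos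
    have hz0 : 0 ≤ z := le_trans (Nat.cast_nonneg b) hbz
    have k2 : 2 * (1 - c) * z ≤ (1 - (c - s * ε)) * (G + (c - s * ε) * b) := by
      rw [← hz2]; linarith
    have hd : 1 - (c - s * ε) ≤ 4 / 3 * (1 - c) := by linarith
    have hdb : (c - s * ε) * b ≤ z := by
      have : (c - s * ε) * b ≤ 1 * b :=
        mul_le_mul_of_nonneg_right (by nlinarith) (Nat.cast_nonneg b)
      linarith
    have hnn : 0 ≤ (G : ℝ) + (c - s * ε) * b :=
      add_nonneg (Nat.cast_nonneg _) (mul_nonneg (by linarith) (Nat.cast_nonneg b))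
    have k3 : 2 * (1 - c) * z ≤ 4 / 3 * (1 - c) * (G + (c - s * ε) * b) :=
      k2.trans (mul_le_mul_of_nonneg_right hd hnn)
    have k4 : (3 / 2) * z ≤ G + (c - s * ε) * b := by
      refine le_of_mul_le_mul_left ?_ hc1'
      linarith
    have k5 : z * e ≤ z * (1 / 4) := mul_le_mul_of_nonneg_left he hz0
    linarith
  exact Nat.floor_le_of_le hfl
end
end

section
/- Define g₁(u) := u − u²/4 and g₂(u) := 2u − u². For every positive integer n and every u ∈ [0, 1/n], the (n−1)-fold iterate satisfies g₁^{(n−1)}(u) ≥ (3/4)·u, and consequently g₂( g₁^{(n−1)}(u) ) ≥ u. -/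
noncomputable section

/-- generating-function iteration estimate from the proof of
Proposition 2.4: with `g₁(u) = u - u²/4` and `g₂(u) = 2u - u²`, for every `n ≥ 1`
and `u ∈ [0, 1/n]`, the `(n-1)`-fold iterate satisfies `g₁^{(n-1)}(u) ≥ (3/4)u`, and
consequently `g₂(g₁^{(n-1)}(u)) ≥ u`. -/
theorem iterate_survival_maps
    (g₁ g₂ : ℝ → ℝ)
    (hg₁ : ∀ u : ℝ, g₁ u = u - u ^ 2 / 4)
    (hg₂ : ∀ u : ℝ, g₂ u = 2 * u - u ^ 2)
    (n : ℕ) (hn : 0 < n)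
    (u : ℝ) (hu : u ∈ Set.Icc (0 : ℝ) (1 / (n : ℝ))) :
    (3 / 4 : ℝ) * u ≤ g₁^[n - 1] u ∧ u ≤ g₂ (g₁^[n - 1] u) := by
  obtain ⟨h0, h1⟩ := hu
  have hn1 : (1 : ℝ) ≤ n := by exact_mod_cast hn
  have hnu : u * n ≤ 1 := by rwa [le_div_iff₀ (by linarith)] at h1
  have hu1 : u ≤ 1 := by nlinarith
  have key : ∀ k : ℕ, u - k * (u ^ 2 / 4) ≤ g₁^[k] u ∧ 0 ≤ g₁^[k] u ∧ g₁^[k] u ≤ u := by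
    intro k
    induction k with
    | zero => simp [h0]
    | succ k ih =>
      rw [Function.iterate_succ_apply', hg₁]
      obtain ⟨a, b, c⟩ := ih
      generalize g₁^[k] u = v at a b c
      push_cast
      refine ⟨by nlinarith, by nlinarith, by nlinarith⟩
  obtain ⟨a, b, c⟩ := key (n - 1)
  rw [hg₂]
  generalize g₁^[n - 1] u = v at a b c
  rw [Nat.cast_sub hn] at a
  push_cast at a
  have hw : 3 / 4 * u + u ^ 2 / 4 ≤ v := by
    nlinarith [mul_le_mul_of_nonneg_left hnu h0]
  refine ⟨by nlinarith, ?_⟩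
  have hm : 2 * (3 / 4 * u + u ^ 2 / 4) - (3 / 4 * u + u ^ 2 / 4) ^ 2 ≤ 2 * v - v ^ 2 := by
    nlinarith [mul_nonneg (sub_nonneg.2 hw) (by nlinarith : 0 ≤ 2 - v - (3 / 4 * u + u ^ 2 / 4))]
  have hp : 0 ≤ u * ((1 - u) * (8 + 7 * u + u ^ 2)) :=
    mul_nonneg h0 (mul_nonneg (by linarith) (by positivity))
  nlinarith [hp]
end
end
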